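/- arXiv:2306.07452 — 2 statements merged into one kernel-verified Lean document; each statement's English description precedes it below -/
import Mathlib

section
/- Let Ω ⊂ ℝ^m be a bounded domain with smooth (C^∞) boundary. Then there is an open neighborhood U of ∂Ω such that the function x ↦ -log(d_{∂Ω}(x)) is subharmonic on Ω ∩ U. -/
open MeasureTheory Metric Filter Topology Set
open scoped ENNReal

noncomputable section

/-- The positive part of an extended real number, as an extended nonnegative real. -/
def erealToENNReal (x : EReal) : ℝ≥0∞ := if x = ⊤ then ⊤ else ENNReal.ofReal x.toReal

variable {E : Type*} [NormedAddCommGroup E] [MeasureSpace E]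

/-- The mean value `M_u(x,r)` of an extended-real-valued function `u` over the ball `B(x,r)`,
computed as the difference of the integrals of the positive and negative parts. -/
def erealBallAvg (u : E → EReal) (x : E) (r : ℝ) : EReal :=
  (((∫⁻ y in ball x r, erealToENNReal (u y)) / volume (ball x r) : ℝ≥0∞) : EReal)
    - (((∫⁻ y in ball x r, erealToENNReal (-(u y))) / volume (ball x r) : ℝ≥0∞) : EReal)

/-- The sub-mean value property on a set `s`: at each point of `s` the value of `u` is at most
its average over every sufficiently small ball centered at the point and contained in `s`. -/
def SubmeanOn (u : E → EReal) (s : Set E) : Prop :=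
  ∀ x ∈ s, ∃ R > 0, ∀ r : ℝ, 0 < r → r < R → closedBall x r ⊆ s →
    u x ≤ erealBallAvg u x r

/-- `u : E → [-∞,∞)` is subharmonic on `s` if it is upper semicontinuous on `s`, not
identically `-∞` on `s`, takes values in `[-∞,∞)`, and satisfies the sub-mean value
inequality on `s`. -/
def IsSubharmonicOn (u : E → EReal) (s : Set E) : Prop :=
  UpperSemicontinuousOn u s ∧ (¬ ∀ x ∈ s, u x = ⊥) ∧ (∀ x ∈ s, u x < ⊤) ∧ SubmeanOn u s

/-- `ρ` is a `C^k` local defining function for the domain `Ω` near the boundary point `p`,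
defined on the open neighborhood `V`: it is `C^k` on `V`, has nonvanishing gradient on the
boundary, is negative exactly on `Ω ∩ V` and vanishes exactly on `∂Ω ∩ V`. -/
def IsLocalDefiningFunction {F : Type*} [NormedAddCommGroup F] [NormedSpace ℝ F]
    (Ω : Set F) (k : ℕ∞) (p : F) (V : Set F) (ρ : F → ℝ) : Prop :=
  IsOpen V ∧ p ∈ V ∧ ContDiffOn ℝ k ρ V ∧
    (∀ q ∈ V ∩ frontier Ω, fderiv ℝ ρ q ≠ 0) ∧
    Ω ∩ V = {q | q ∈ V ∧ ρ q < 0} ∧ frontier Ω ∩ V = {q | q ∈ V ∧ ρ q = 0}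

/-- `Ω` has `C^k`-smooth boundary: every boundary point admits a `C^k` local defining
function. -/
def HasCkBoundary {F : Type*} [NormedAddCommGroup F] [NormedSpace ℝ F]
    (Ω : Set F) (k : ℕ∞) : Prop :=
  ∀ p ∈ frontier Ω, ∃ V ρ, IsLocalDefiningFunction Ω k p V ρ

section Geometry

variable {F : Type*} [NormedAddCommGroup F] [InnerProductSpace ℝ F]

theorem infDist_frontier_le_dist [FiniteDimensional ℝ F] {Ω : Set F} {x z : F} (hx : x ∈ Ω)
    (hz : z ∉ Ω) : infDist x (frontier Ω) ≤ dist x z := by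
  obtain ⟨y, hy, hxy⟩ := exists_mem_frontier_infDist_compl_eq_dist hx
    (fun h => hz (h ▸ mem_univ z))
  exact (infDist_le_dist_of_mem hy).trans (hxy ▸ infDist_le_dist_of_mem hz)

theorem infDist_frontier_le_sub_of_disjoint_closedBall [FiniteDimensional ℝ F] {Ω : Set F}
    {y c : F} {r : ℝ} (hr : 0 < r) (hy : y ∈ Ω) (hc : Disjoint (closedBall c r) Ω) :
    infDist y (frontier Ω) ≤ ‖y - c‖ - r := by
  have hlt : r < ‖y - c‖ := by
    by_contra! h
    exact hc.le_bot ⟨by simpa [dist_eq_norm] using h, hy⟩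
  have hpos : 0 < ‖y - c‖ := hr.trans hlt
  have hz : c + (r / ‖y - c‖) • (y - c) ∉ Ω := by
    refine fun h => hc.le_bot ⟨?_, h⟩
    rw [mem_closedBall, dist_eq_norm, add_sub_cancel_left, norm_smul, Real.norm_eq_abs,
      abs_of_pos (by positivity), div_mul_cancel₀ _ hpos.ne']
  refine (infDist_frontier_le_dist hy hz).trans_eq ?_
  have : y - (c + (r / ‖y - c‖) • (y - c)) = (1 - r / ‖y - c‖) • (y - c) := by
    rw [sub_smul, one_smul]; abel
  rw [dist_eq_norm, this, norm_smul, Real.norm_eq_abs,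
    abs_of_nonneg (by rw [sub_nonneg, div_le_one hpos]; exact hlt.le)]
  field_simp

theorem eq_mul_inner_of_nonpos_on_halfspace {n : F} (hn : ‖n‖ = 1) {L : F →L[ℝ] ℝ}
    (hL : ∀ w, inner ℝ n w < 0 → L w ≤ 0) (w : F) : L w = L n * inner ℝ n w := by
  have hnn : inner ℝ n n = (1 : ℝ) := by rw [real_inner_self_eq_norm_sq, hn, one_pow]
  have key : ∀ v, inner ℝ n v = (0 : ℝ) → L v ≤ 0 := by
    intro v hv
    have hLn : 0 ≤ L n := by
      have := hL (-n) (by rw [inner_neg_right, hnn]; norm_num)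
      simpa using this
    by_contra! hlt
    have := hL (v - (L v / (2 * (L n + 1))) • n) (by
      rw [inner_sub_right, inner_smul_right, hv, hnn]
      have : 0 < L v / (2 * (L n + 1)) := by positivity
      linarith)
    rw [map_sub, map_smul, smul_eq_mul, sub_nonpos, div_mul_eq_mul_div,
      le_div_iff₀ (by positivity)] at this
    nlinarith
  have hv : inner ℝ n (w - (inner ℝ n w : ℝ) • n) = (0 : ℝ) := by
    rw [inner_sub_right, inner_smul_right, hnn, mul_one, sub_self]
  have h1 := key _ hv
  have h2 := key (-(w - (inner ℝ n w : ℝ) • n)) (by rw [inner_neg_right, hv, neg_zero])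
  rw [map_neg] at h2
  rw [map_sub, map_smul, smul_eq_mul] at h1 h2
  linarith

theorem norm_le_apply_of_nonpos_on_halfspace {n : F} (hn : ‖n‖ = 1) {L : F →L[ℝ] ℝ}
    (hL : ∀ w, inner ℝ n w < 0 → L w ≤ 0) : ‖L‖ ≤ L n := by
  have hLn : 0 ≤ L n := by
    have := hL (-n) (by rw [inner_neg_right, real_inner_self_eq_norm_sq, hn]; norm_num)
    simpa using this
  refine L.opNorm_le_bound hLn fun w => ?_
  rw [eq_mul_inner_of_nonpos_on_halfspace hn hL w, norm_mul, Real.norm_of_nonneg hLn]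
  gcongr
  simpa [hn] using norm_inner_le_norm (𝕜 := ℝ) n w

theorem ContDiffAt.exists_norm_sub_sub_fderiv_le {f : F → ℝ} {x : F} (hf : ContDiffAt ℝ 2 f x) :
    ∃ K : ℝ, 0 < K ∧ ∃ ε > 0, ∀ p ∈ ball x ε, ∀ y ∈ ball x ε,
      |f y - f p - fderiv ℝ f p (y - p)| ≤ K * ‖y - p‖ ^ 2 := by
  obtain ⟨K, t, ht, hK⟩ :=
    (hf.fderiv_right (m := 1) (by norm_num)).exists_lipschitzOnWith
  have hd : ∀ᶠ y in 𝓝 x, DifferentiableAt ℝ f y :=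
    (hf.eventually (by simp)).mono fun y hy => hy.differentiableAt (by simp)
  obtain ⟨ε, hε, hball⟩ := Metric.mem_nhds_iff.1 (Filter.inter_mem ht hd)
  refine ⟨K + 1, by positivity, ε, hε, fun p hp y hy => ?_⟩
  have hconv : Convex ℝ (ball x ε ∩ closedBall p ‖y - p‖) :=
    (convex_ball _ _).inter (convex_closedBall _ _)
  have := hconv.norm_image_sub_le_of_norm_fderiv_le' (𝕜 := ℝ) (f := f) (φ := fderiv ℝ f p)
    (C := K * ‖y - p‖) (x := p) (y := y) (fun z hz => (hball hz.1).2) (fun z hz => ?_)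
    ⟨hp, mem_closedBall_self (norm_nonneg _)⟩ ⟨hy, by rw [mem_closedBall, dist_eq_norm]⟩
  · rw [Real.norm_eq_abs] at this
    refine this.trans ?_
    nlinarith [sq_nonneg ‖y - p‖]
  · have h1 := hK.norm_sub_le (hball hz.1).1 (hball hp).1
    refine h1.trans ?_
    have := mem_closedBall_iff_norm.1 hz.2
    gcongr

/-- Boundary points of a `C²` domain near a given one that are nearest to an interior point
admit an exterior ball of uniform radius, centered on the prolonged normal. -/
theorem IsLocalDefiningFunction.exists_disjoint_closedBall [FiniteDimensional ℝ F] {Ω : Set F}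
    {k : ℕ∞} (hk : 2 ≤ k) {p₀ : F} (hp₀ : p₀ ∈ frontier Ω) {V : Set F} {ρ : F → ℝ}
    (h : IsLocalDefiningFunction Ω k p₀ V ρ) :
    ∃ ε > 0, ∃ r > 0, ∀ p ∈ frontier Ω ∩ ball p₀ ε, ∀ x ∈ Ω, ∀ n : F, ‖n‖ = 1 →
      p = x + infDist x (frontier Ω) • n → 0 < infDist x (frontier Ω) →
      Disjoint (closedBall (p + r • n) r) Ω := by
  obtain ⟨hV, hpV, hρ, hgrad, hneg, hzero⟩ := h
  have hk' : (2 : WithTop ℕ∞) ≤ (k : WithTop ℕ∞) := WithTop.coe_le_coe.2 hk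
  have hC2 : ContDiffAt ℝ 2 ρ p₀ := (hρ.contDiffAt (hV.mem_nhds hpV)).of_le hk'
  obtain ⟨K, hK, ε₁, hε₁, htaylor⟩ := hC2.exists_norm_sub_sub_fderiv_le
  have hg : 0 < ‖fderiv ℝ ρ p₀‖ := norm_pos_iff.2 (hgrad p₀ ⟨hpV, hp₀⟩)
  set a := ‖fderiv ℝ ρ p₀‖ / 2 with ha
  have hcont : ContinuousAt (fun p => ‖fderiv ℝ ρ p‖) p₀ :=
    (hC2.fderiv_right (m := 1) (by norm_num)).continuousAt.norm
  have hev : ∀ᶠ p in 𝓝 p₀, a < ‖fderiv ℝ ρ p‖ ∧ p ∈ V ∧ p ∈ ball p₀ ε₁ :=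
    (hcont.eventually_const_lt (by linarith)).and
      ((hV.eventually_mem hpV).and (ball_mem_nhds p₀ hε₁))
  obtain ⟨ε, hε, hball⟩ := Metric.mem_nhds_iff.1 hev
  have hapos : 0 < a := by positivity
  refine ⟨ε / 2, by positivity, min (a / (2 * K)) (ε / 8), by positivity, ?_⟩
  intro p ⟨hpf, hp⟩ x hx n hn hpx hδ
  set δ := infDist x (frontier Ω)
  set r := min (a / (2 * K)) (ε / 8)
  have hrpos : 0 < r := by positivity
  have hp' : p ∈ ball p₀ ε := ball_subset_ball (by linarith) hp
  obtain ⟨hap, hpV', hp1⟩ := hball hp'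
  have hρp : ρ p = 0 := by
    have : p ∈ frontier Ω ∩ V := ⟨hpf, hpV'⟩
    rw [hzero] at this
    exact this.2
  have hder : HasFDerivAt ρ (fderiv ℝ ρ p) p :=
    ((hρ.contDiffAt (hV.mem_nhds hpV')).differentiableAt
      (by intro h0; rw [h0] at hk'; norm_num at hk')).hasFDerivAt
  have hL : ∀ w, inner ℝ n w < 0 → fderiv ℝ ρ p w ≤ 0 := by
    intro w hw
    have hlin : HasDerivAt (fun t : ℝ => p + t • w) w 0 := by
      simpa using ((hasDerivAt_id (0 : ℝ)).smul_const w).const_add p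
    have hcomp : HasDerivAt (fun t : ℝ => ρ (p + t • w)) (fderiv ℝ ρ p w) 0 := by
      have : HasFDerivAt ρ (fderiv ℝ ρ p) (p + (0 : ℝ) • w) := by simpa using hder
      exact this.comp_hasDerivAt 0 hlin
    by_contra! hpos
    have hslope := hasDerivAt_iff_tendsto_slope.1 hcomp
    have hslope' := hslope.mono_left (nhdsWithin_mono 0 (show Ioi (0 : ℝ) ⊆ {0}ᶜ from
      fun t ht => (ne_of_gt ht)))
    have e1 := hslope'.eventually (lt_mem_nhds hpos)
    have e2 : ∀ᶠ t in 𝓝[>] (0 : ℝ), p + t • w ∈ V := by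
      have : Tendsto (fun t : ℝ => p + t • w) (𝓝[>] 0) (𝓝 p) := by
        simpa using (hlin.continuousAt.tendsto.mono_left nhdsWithin_le_nhds)
      exact this.eventually (hV.mem_nhds hpV')
    have e3 : ∀ᶠ t in 𝓝[>] (0 : ℝ), t * ‖w‖ ^ 2 < -(2 * δ * inner ℝ n w) := by
      have : Tendsto (fun t : ℝ => t * ‖w‖ ^ 2) (𝓝[>] 0) (𝓝 0) := by
        have : Continuous (fun t : ℝ => t * ‖w‖ ^ 2) := by fun_prop
        simpa using (this.tendsto 0).mono_left nhdsWithin_le_nhds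
      exact this.eventually (gt_mem_nhds (by nlinarith))
    obtain ⟨t, ⟨⟨ht1, ht2⟩, ht3⟩, ht0⟩ := (((e1.and e2).and e3).and self_mem_nhdsWithin).exists
    have ht0 : 0 < t := ht0
    have hmem : p + t • w ∈ Ω := by
      by_contra hnot
      have hle := infDist_frontier_le_dist hx hnot
      rw [dist_comm, dist_eq_norm] at hle
      have hsq : ‖p + t • w - x‖ ^ 2 = δ ^ 2 + 2 * δ * (t * inner ℝ n w) + t ^ 2 * ‖w‖ ^ 2 := by
        have : p + t • w - x = δ • n + t • w := by rw [hpx]; abel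
        rw [this, norm_add_sq_real, norm_smul, norm_smul, hn, inner_smul_left, inner_smul_right,
          Real.norm_eq_abs, Real.norm_eq_abs, mul_pow, mul_pow, sq_abs, sq_abs]
        simp
        ring
      have : δ ^ 2 ≤ ‖p + t • w - x‖ ^ 2 := by gcongr
      nlinarith
    have hlt : ρ (p + t • w) < 0 := by
      have : p + t • w ∈ Ω ∩ V := ⟨hmem, ht2⟩
      rw [hneg] at this
      exact this.2
    rw [slope_def_field] at ht1
    simp only [zero_smul, add_zero, hρp, sub_zero] at ht1
    exact absurd (div_neg_of_neg_of_pos hlt ht0) ht1.not_gt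
  rw [Set.disjoint_left]
  intro y hy hyΩ
  have hyc : ‖(y - p) - r • n‖ ≤ r := by
    rw [mem_closedBall_iff_norm] at hy
    rwa [sub_sub]
  have hyp : ‖y - p‖ ≤ 2 * r := by
    have := norm_add_le ((y - p) - r • n) (r • n)
    rw [sub_add_cancel, norm_smul, hn, Real.norm_of_nonneg hrpos.le] at this
    linarith
  have hyball : y ∈ ball p₀ ε := by
    rw [mem_ball_iff_norm] at hp ⊢
    have h1 := norm_add_le (y - p) (p - p₀)
    rw [sub_add_sub_cancel] at h1
    have : r ≤ ε / 8 := min_le_right _ _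
    linarith
  have hquad : ‖y - p‖ ^ 2 ≤ 2 * r * inner ℝ n (y - p) := by
    have h1 : ‖(y - p) - r • n‖ ^ 2 ≤ r ^ 2 := by gcongr
    rw [norm_sub_sq_real, norm_smul, hn, Real.norm_of_nonneg hrpos.le, inner_smul_right,
      real_inner_comm] at h1
    linarith
  have hT := (abs_le.1 (htaylor p hp1 y (hball hyball).2.2)).1
  have hρy : ρ y < 0 := by
    have : y ∈ Ω ∩ V := ⟨hyΩ, (hball hyball).2.1⟩
    rw [hneg] at this
    exact this.2
  rw [hρp, eq_mul_inner_of_nonpos_on_halfspace hn hL (y - p)] at hT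
  have hLn := norm_le_apply_of_nonpos_on_halfspace hn hL
  have hrK : 2 * K * r ≤ a := by
    have : r ≤ a / (2 * K) := min_le_left _ _
    rw [le_div_iff₀ (by positivity)] at this
    linarith
  have hinner : 0 ≤ inner ℝ n (y - p) := by
    by_contra! hlt
    nlinarith [sq_nonneg ‖y - p‖]
  have : K * ‖y - p‖ ^ 2 ≤ fderiv ℝ ρ p n * inner ℝ n (y - p) := by
    calc K * ‖y - p‖ ^ 2 ≤ K * (2 * r * inner ℝ n (y - p)) := by gcongr
      _ = 2 * K * r * inner ℝ n (y - p) := by ring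
      _ ≤ _ := by gcongr; linarith
  linarith

end Geometry

theorem Real.log_one_add_le_sub_sq_div_four {t : ℝ} (ht : |t| ≤ 1 / 5) :
    Real.log (1 + t) ≤ t - t ^ 2 / 4 := by
  have h := (abs_le.1 (Real.abs_log_sub_add_sum_range_le (x := -t)
    (by rw [abs_neg]; linarith) 2)).2
  rw [Finset.sum_range_succ, Finset.sum_range_one, abs_neg] at h
  have h3 : |t| ^ (2 + 1) / (1 - |t|) ≤ t ^ 2 / 4 := by
    rw [div_le_iff₀ (by linarith), ← sq_abs t]
    nlinarith [sq_nonneg |t|, abs_nonneg t]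
  norm_num at h
  linarith

/-- Lower bound for `-log d` when `d` lies below `δ - a + t² / (2D)`, a quadratic upper bound for
the distance to a sphere. -/
theorem neg_log_ge_of_le_quadratic {m δ D a t d : ℝ} (hm : 1 ≤ m) (hδ : 0 < δ)
    (hD : 8 * m * δ ≤ D) (hat : |a| ≤ t) (ht : t ≤ δ / 10) (hd : 0 < d)
    (hle : d ≤ δ - a + t ^ 2 / (2 * D)) :
    -Real.log δ + a / δ + (a ^ 2 - t ^ 2 / m) / (8 * δ ^ 2) ≤ -Real.log d := by
  have hmδ : δ ≤ m * δ := by nlinarith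
  have hDpos : 0 < D := by linarith
  have ht0 : 0 ≤ t := (abs_nonneg a).trans hat
  set b := a / δ with hb
  set s := t / δ with hs
  set q := t ^ 2 / (2 * D) / δ with hq
  have hs0 : 0 ≤ s := by positivity
  have hs1 : s ≤ 1 / 10 := by rw [hs, div_le_iff₀ hδ]; linarith
  have hbs : |b| ≤ s := by rw [hb, hs, abs_div, abs_of_pos hδ]; gcongr
  have hq0 : 0 ≤ q := by positivity
  have hqs : q ≤ s ^ 2 / m / 16 := by
    have : q ≤ t ^ 2 / (2 * (8 * m * δ)) / δ := by rw [hq]; gcongr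
    refine this.trans_eq ?_
    rw [hs]; field_simp; ring
  have hsm : s ^ 2 / m ≤ 1 / 100 := by
    rw [div_le_iff₀ (by linarith)]; nlinarith
  have hle' : d ≤ δ * (1 + (-b + q)) := by
    refine hle.trans_eq ?_
    rw [hb, hq]; field_simp; ring
  have hb' := abs_le.1 hbs
  have habs : |-b + q| ≤ 1 / 5 := by
    rw [abs_le]; constructor <;> linarith
  have hpos : 0 < 1 + (-b + q) := by linarith [(abs_le.1 habs).1]
  have hlog : Real.log d ≤ Real.log δ + Real.log (1 + (-b + q)) := by
    rw [← Real.log_mul hδ.ne' hpos.ne']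
    exact Real.log_le_log hd hle'
  have h4 := Real.log_one_add_le_sub_sq_div_four habs
  have hrw : (a ^ 2 - t ^ 2 / m) / (8 * δ ^ 2) = b ^ 2 / 8 - s ^ 2 / m / 8 := by
    rw [hb, hs]; field_simp
  rw [hrw]
  nlinarith [sq_nonneg (b - 2 * q)]

section Averages

variable {G : Type*} [NormedAddCommGroup G] [InnerProductSpace ℝ G] [FiniteDimensional ℝ G]
  [MeasurableSpace G] [BorelSpace G]

theorem setIntegral_ball_eq_ball_zero (g : G → ℝ) (x : G) (s : ℝ) :
    ∫ y in ball x s, g (y - x) = ∫ h in ball (0 : G) s, g h := by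
  have := (measurePreserving_sub_right (volume : Measure G) x).setIntegral_preimage_emb
    (MeasurableEquiv.subRight x).measurableEmbedding g (ball 0 s)
  rw [← this]
  congr 2
  ext y
  simp [dist_eq_norm]

theorem setIntegral_ball_zero_comp_isometry (φ : G ≃ₗᵢ[ℝ] G) (g : G → ℝ) (s : ℝ) :
    ∫ h in ball (0 : G) s, g (φ h) = ∫ h in ball (0 : G) s, g h := by
  have := φ.measurePreserving.setIntegral_preimage_emb
    φ.toHomeomorph.measurableEmbedding g (ball 0 s)
  rw [← this]
  congr 2
  ext y
  simp

theorem setIntegral_ball_zero_inner (n : G) (s : ℝ) :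
    ∫ h in ball (0 : G) s, inner ℝ n h = (0 : ℝ) := by
  have := setIntegral_ball_zero_comp_isometry (LinearIsometryEquiv.neg ℝ)
    (fun h : G => inner ℝ n h) s
  simp only [LinearIsometryEquiv.coe_neg, inner_neg_right, integral_neg] at this
  linarith

theorem Continuous.integrableOn_ball {g : G → ℝ} (hg : Continuous g) (x : G) (s : ℝ) :
    IntegrableOn g (ball x s) :=
  (hg.continuousOn.integrableOn_compact (isCompact_closedBall x s)).mono_set ball_subset_closedBall

theorem setIntegral_ball_zero_inner_sq {n : G} (hn : ‖n‖ = 1) (s : ℝ) :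
    (Module.finrank ℝ G : ℝ) * ∫ h in ball (0 : G) s, (inner ℝ n h : ℝ) ^ 2 =
      ∫ h in ball (0 : G) s, ‖h‖ ^ 2 := by
  set b := stdOrthonormalBasis ℝ G
  have hi : ∀ i, ∫ h in ball (0 : G) s, (inner ℝ (b i) h : ℝ) ^ 2 =
      ∫ h in ball (0 : G) s, (inner ℝ n h : ℝ) ^ 2 := by
    intro i
    set φ := (ℝ ∙ (n - b i))ᗮ.reflection
    have hφ : φ n = b i := Submodule.reflection_sub (by rw [hn, b.norm_eq_one])
    rw [← setIntegral_ball_zero_comp_isometry φ]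
    simp only [← hφ, LinearIsometryEquiv.inner_map_map]
  have hsum : ∀ h : G, ‖h‖ ^ 2 = ∑ i, (inner ℝ (b i) h : ℝ) ^ 2 := by
    intro h
    rw [← b.sum_sq_norm_inner_right h]
    simp only [Real.norm_eq_abs, sq_abs]
  simp only [hsum]
  rw [integral_finsetSum _ fun i _ => Continuous.integrableOn_ball (by fun_prop) 0 s]
  simp [hi]

/-- A function bounded below near `x` by a quadratic polynomial of vanishing Laplacian
that agrees with it at `x` is at most its averages. -/
theorem mul_le_setIntegral_ball_of_le {f : G → ℝ} {x n : G} {s α κ A : ℝ} (hn : ‖n‖ = 1)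
    (hf : IntegrableOn f (ball x s))
    (hle : ∀ y ∈ ball x s, A + α * inner ℝ n (y - x) +
      κ * ((inner ℝ n (y - x) : ℝ) ^ 2 - ‖y - x‖ ^ 2 / Module.finrank ℝ G) ≤ f y) :
    A * (volume (ball x s)).toReal ≤ ∫ y in ball x s, f y := by
  have : Nontrivial G := ⟨n, 0, by rintro rfl; simp at hn⟩
  have hm' : (Module.finrank ℝ G : ℝ) ≠ 0 := Nat.cast_ne_zero.2 Module.finrank_pos.ne'
  refine le_trans (le_of_eq ?_) (setIntegral_mono_on (Continuous.integrableOn_ball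
    (by fun_prop) x s) hf measurableSet_ball hle)
  rw [setIntegral_ball_eq_ball_zero (fun h => A + α * inner ℝ n h +
    κ * ((inner ℝ n h : ℝ) ^ 2 - ‖h‖ ^ 2 / Module.finrank ℝ G))]
  rw [integral_add (Continuous.integrableOn_ball (by fun_prop) 0 s)
      (Continuous.integrableOn_ball (by fun_prop) 0 s),
    integral_add (Continuous.integrableOn_ball (by fun_prop) 0 s)
      (Continuous.integrableOn_ball (by fun_prop) 0 s),
    integral_const_mul, integral_const_mul,
    integral_sub (Continuous.integrableOn_ball (by fun_prop) 0 s)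
      (Continuous.integrableOn_ball (by fun_prop) 0 s),
    integral_div, setIntegral_ball_zero_inner, ← setIntegral_ball_zero_inner_sq hn]
  rw [mul_div_cancel_left₀ _ hm', sub_self, setIntegral_const, smul_eq_mul, Measure.real,
    Measure.addHaar_ball_center volume x]
  ring

theorem erealBallAvg_coe {f : G → ℝ} {x : G} {s : ℝ} (hs : 0 < s)
    (hf : IntegrableOn f (ball x s)) : erealBallAvg (fun y => (f y : EReal)) x s =
    (((∫ y in ball x s, f y) / (volume (ball x s)).toReal : ℝ) : EReal) := by
  have hpos : ∫⁻ y in ball x s, ENNReal.ofReal (f y) ≠ ⊤ := hf.lintegral_lt_top.ne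
  have hneg : ∫⁻ y in ball x s, ENNReal.ofReal (-f y) ≠ ⊤ := hf.neg.lintegral_lt_top.ne
  have hcoe : ∀ a : ℝ≥0∞, a ≠ ⊤ →
      ((a / volume (ball x s) : ℝ≥0∞) : EReal) =
        ((a.toReal / (volume (ball x s)).toReal : ℝ) : EReal) := by
    intro a ha
    rw [← ENNReal.toReal_div,
      EReal.coe_ennreal_toReal (ENNReal.div_ne_top ha (measure_ball_pos _ _ hs).ne')]
  unfold erealBallAvg erealToENNReal
  simp only [← EReal.coe_neg, EReal.coe_ne_top, if_false, EReal.toReal_coe]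
  rw [hcoe _ hpos, hcoe _ hneg, ← EReal.coe_sub, ← sub_div,
    integral_eq_lintegral_pos_part_sub_lintegral_neg_part hf]

end Averages

/-- Theorem (statement 5): if `Ω ⊆ ℝᵐ` is a bounded domain with `C^∞` boundary, then there is
an open neighborhood `U` of `∂Ω` on which `-log(d_{∂Ω})` is subharmonic (on `Ω ∩ U`). -/
theorem negLogDist_subharmonic_near_boundary (m : ℕ) (Ω : Set (EuclideanSpace ℝ (Fin m)))
    (hopen : IsOpen Ω) (hconn : IsConnected Ω) (hbdd : Bornology.IsBounded Ω)
    (hsmooth : HasCkBoundary Ω ⊤) :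
    ∃ U : Set (EuclideanSpace ℝ (Fin m)), IsOpen U ∧ frontier Ω ⊆ U ∧
      IsSubharmonicOn
        (fun x => ((- Real.log (infDist x (frontier Ω)) : ℝ) : EReal)) (Ω ∩ U) := by
  rcases (frontier Ω).eq_empty_or_nonempty with hempty | hne
  · refine ⟨univ, isOpen_univ, subset_univ _, ?_, ?_, ?_, ?_⟩
    · simp only [hempty, infDist_empty]
      exact continuousOn_const.upperSemicontinuousOn
    · obtain ⟨x, hx⟩ := hconn.nonempty
      exact fun h => EReal.coe_ne_bot _ (h x ⟨hx, mem_univ x⟩)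
    · exact fun x _ => EReal.coe_lt_top _
    · refine fun x _ => ⟨1, one_pos, fun r hr _ _ => ?_⟩
      simp only [hempty, infDist_empty]
      rw [erealBallAvg_coe hr (by simp)]
      simp
  have hloc : ∀ p₀ : frontier Ω, ∃ ε > 0, ∃ r > 0,
      ∀ p ∈ frontier Ω ∩ ball (p₀ : EuclideanSpace ℝ (Fin m)) ε, ∀ x ∈ Ω,
      ∀ n : EuclideanSpace ℝ (Fin m), ‖n‖ = 1 →
      p = x + infDist x (frontier Ω) • n → 0 < infDist x (frontier Ω) →
      Disjoint (closedBall (p + r • n) r) Ω := by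
    intro p₀
    obtain ⟨V, ρ, h⟩ := hsmooth p₀ p₀.2
    exact h.exists_disjoint_closedBall le_top p₀.2
  choose ε hε r hr hball using hloc
  have hpos : ∀ x ∈ Ω, 0 < infDist x (frontier Ω) := fun x hx =>
    (isClosed_frontier.notMem_iff_infDist_pos hne).1 fun h =>
      (hopen.inter_frontier_eq ▸ ⟨hx, h⟩ : x ∈ (∅ : Set (EuclideanSpace ℝ (Fin m))))
  have hcont : ContinuousOn (fun x => -Real.log (infDist x (frontier Ω))) Ω :=
    ((continuous_infDist_pt _).continuousOn.log fun x hx => (hpos x hx).ne').neg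
  set η : frontier Ω → ℝ := fun p => min (ε p / 2) (r p / (8 * m + 1))
  have hηpos : ∀ p, 0 < η p := fun p => by
    have := hε p
    have := hr p
    positivity
  refine ⟨⋃ p : frontier Ω, ball (p : EuclideanSpace ℝ (Fin m)) (η p),
    isOpen_iUnion fun p => isOpen_ball,
    fun p hp => mem_iUnion.2 ⟨⟨p, hp⟩, mem_ball_self (hηpos _)⟩, ?_, ?_, ?_, ?_⟩
  · exact (continuous_coe_real_ereal.comp_continuousOn
      (hcont.mono inter_subset_left)).upperSemicontinuousOn
  · obtain ⟨p, hp⟩ := hne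
    obtain ⟨x, hx, hxΩ⟩ := mem_closure_iff.1 (frontier_subset_closure hp) _ isOpen_ball
      (mem_ball_self (hηpos ⟨p, hp⟩))
    exact fun h => EReal.coe_ne_bot _ (h x ⟨hxΩ, mem_iUnion.2 ⟨⟨p, hp⟩, hx⟩⟩)
  · exact fun x _ => EReal.coe_lt_top _
  rintro x ⟨hxΩ, hxU⟩
  obtain ⟨p₀, hp₀⟩ := mem_iUnion.1 hxU
  obtain ⟨p, hpf, hxp⟩ := isClosed_frontier.exists_infDist_eq_dist hne x
  have hδ := hpos x hxΩ
  set δ := infDist x (frontier Ω)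
  have hδη : δ < η p₀ := (infDist_le_dist_of_mem p₀.2).trans_lt hp₀
  obtain ⟨n, hndef⟩ : ∃ n, n = δ⁻¹ • (p - x) := ⟨_, rfl⟩
  have hn : ‖n‖ = 1 := by
    rw [hndef, norm_smul, norm_inv, Real.norm_of_nonneg hδ.le, ← dist_eq_norm, dist_comm, ← hxp,
      inv_mul_cancel₀ hδ.ne']
  have hpx : p = x + δ • n := by
    rw [hndef, smul_inv_smul₀ hδ.ne', add_sub_cancel]
  have hpball : p ∈ ball (p₀ : EuclideanSpace ℝ (Fin m)) (ε p₀) := by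
    have h1 := dist_triangle_left p (p₀ : EuclideanSpace ℝ (Fin m)) x
    have h2 : η p₀ ≤ ε p₀ / 2 := min_le_left _ _
    rw [mem_ball] at hp₀ ⊢
    linarith
  have hdisj := hball p₀ p ⟨hpf, hpball⟩ x hxΩ n hn hpx hδ
  have hm : (1 : ℝ) ≤ m := by
    rcases Nat.eq_zero_or_pos m with rfl | hm
    · simp [Subsingleton.elim n 0] at hn
    · exact_mod_cast hm
  set D := r p₀ + δ with hDdef
  have hD : 8 * m * δ ≤ D := by
    have h2 : η p₀ ≤ r p₀ / (8 * m + 1) := min_le_right _ _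
    have h3 : δ ≤ r p₀ / (8 * m + 1) := hδη.le.trans h2
    rw [le_div_iff₀ (by positivity)] at h3
    linarith
  have hDpos : 0 < D := add_pos (hr p₀) hδ
  refine ⟨δ / 10, by positivity, fun s hs hsR hsub => ?_⟩
  have hint : IntegrableOn (fun y => -Real.log (infDist y (frontier Ω))) (ball x s) :=
    ((hcont.mono fun y hy => (hsub hy).1).integrableOn_compact
      (isCompact_closedBall x s)).mono_set ball_subset_closedBall
  rw [erealBallAvg_coe hs hint, EReal.coe_le_coe_iff,
    le_div_iff₀ (ENNReal.toReal_pos (measure_ball_pos _ _ hs).ne' measure_ball_lt_top.ne)]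
  refine mul_le_setIntegral_ball_of_le (α := 1 / δ) (κ := 1 / (8 * δ ^ 2)) hn hint
    fun y hy => ?_
  rw [finrank_euclideanSpace_fin]
  have hyΩ : y ∈ Ω := (hsub (ball_subset_closedBall hy)).1
  have hyx : ‖y - x‖ < s := mem_ball_iff_norm.1 hy
  have hquad : infDist y (frontier Ω) ≤ δ - inner ℝ n (y - x) + ‖y - x‖ ^ 2 / (2 * D) := by
    refine (infDist_frontier_le_sub_of_disjoint_closedBall (hr p₀) hyΩ hdisj).trans ?_
    have hsq : ‖y - (p + r p₀ • n)‖ ^ 2 = ‖y - x‖ ^ 2 - 2 * D * inner ℝ n (y - x) + D ^ 2 := by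
      have : y - (p + r p₀ • n) = (y - x) - D • n := by
        rw [hDdef, add_smul, hpx]; abel
      rw [this, norm_sub_sq_real, norm_smul, hn, Real.norm_of_nonneg hDpos.le, inner_smul_right,
        real_inner_comm]
      ring
    have hamgm : ‖y - (p + r p₀ • n)‖ ≤ (‖y - (p + r p₀ • n)‖ ^ 2 + D ^ 2) / (2 * D) := by
      rw [le_div_iff₀ (by positivity)]
      nlinarith [sq_nonneg (‖y - (p + r p₀ • n)‖ - D)]
    rw [hsq] at hamgm
    have : (‖y - x‖ ^ 2 - 2 * D * inner ℝ n (y - x) + D ^ 2 + D ^ 2) / (2 * D) =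
        ‖y - x‖ ^ 2 / (2 * D) - inner ℝ n (y - x) + D := by
      field_simp; ring
    rw [this] at hamgm
    linarith
  have habs : |(inner ℝ n (y - x) : ℝ)| ≤ ‖y - x‖ := by
    simpa [hn] using abs_real_inner_le_norm n (y - x)
  refine le_trans (le_of_eq ?_) (neg_log_ge_of_le_quadratic hm hδ hD habs (by linarith)
    (hpos y hyΩ) hquad)
  ring

end
end

section
/- Let Ω ⊂ ℂⁿ be a bounded Levi pseudoconvex domain with C² boundary. Then, viewing Ω as a domain in ℝ^{2n}, the function z ↦ -log(d_{∂Ω}(z)) is subharmonic on the whole domain Ω. -/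
open MeasureTheory Metric Filter Topology Set
open scoped ENNReal

noncomputable section

/-- Equip `ℂⁿ ≅ ℝ²ⁿ` with its Borel σ-algebra and the Lebesgue measure coming from its real
inner product space structure. -/
instance (n : ℕ) : MeasurableSpace (EuclideanSpace ℂ (Fin n)) := borel _
instance (n : ℕ) : BorelSpace (EuclideanSpace ℂ (Fin n)) := ⟨rfl⟩


variable {E : Type*} [NormedAddCommGroup E] [MeasureSpace E]

/-- `Ω ⊆ ℂⁿ` is Levi pseudoconvex: for every boundary point `p`, every local `C²` defining
function `ρ` near `p` and every complex tangent vector `X` at `p` (i.e. `X` and `i•X` are both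
annihilated by `dρ(p)`), the Levi form of `ρ` at `p` in the direction `X` is nonnegative.
The Levi form is expressed through the real Hessian `H` of `ρ` by the standard identity
`4·L(ρ)(X,X) = H(X,X) + H(iX,iX)`. -/
def LeviPseudoconvex {n : ℕ} (Ω : Set (EuclideanSpace ℂ (Fin n))) : Prop :=
  ∀ p ∈ frontier Ω, ∀ V ρ, IsLocalDefiningFunction Ω 2 p V ρ →
    ∀ X : EuclideanSpace ℂ (Fin n),
      fderiv ℝ ρ p X = 0 → fderiv ℝ ρ p (Complex.I • X) = 0 →
      0 ≤ fderiv ℝ (fun q => fderiv ℝ ρ q X) p X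
          + fderiv ℝ (fun q => fderiv ℝ ρ q (Complex.I • X)) p (Complex.I • X)

/-- Second-order Taylor expansion of a `C²` function on a normed space. -/
theorem ContDiffAt.taylor_two_isLittleO {E : Type*} [NormedAddCommGroup E] [NormedSpace ℝ E]
    {f : E → ℝ} {x : E} (hf : ContDiffAt ℝ 2 f x) :
    (fun h => f (x + h) - f x - fderiv ℝ f x h - 1 / 2 * fderiv ℝ (fderiv ℝ f) x h h)
      =o[𝓝 0] fun h => ‖h‖ ^ 2 := by
  set D := fderiv ℝ f with hD
  set H := fderiv ℝ D x with hH
  have hsymm : ∀ v w, H v w = H w v := fun v w => hf.isSymmSndFDerivAt (by simp) v w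
  have hDx : HasFDerivAt D H x :=
    ((hf.fderiv_right (m := 1) (by norm_num)).differentiableAt one_ne_zero).hasFDerivAt
  have hdiff : ∀ᶠ y in 𝓝 x, DifferentiableAt ℝ f y :=
    (hf.eventually (by simp)).mono fun y hy => hy.differentiableAt two_ne_zero
  rw [Asymptotics.isLittleO_iff]
  intro c hc
  have h1 := (hasFDerivAt_iff_isLittleO_nhds_zero.1 hDx)
  rw [Asymptotics.isLittleO_iff] at h1
  have h2 : ∀ᶠ h in 𝓝 (0 : E), DifferentiableAt ℝ f (x + h) := by
    have : Tendsto (fun h : E => x + h) (𝓝 0) (𝓝 x) := by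
      simpa using (continuous_const_add x).tendsto 0
    exact this.eventually hdiff
  obtain ⟨r, hr, hball⟩ := Metric.eventually_nhds_iff_ball.1 ((h1 hc).and h2)
  filter_upwards [Metric.ball_mem_nhds 0 hr] with h hh
  set G : E → ℝ := fun h => f (x + h) - f x - D x h - 1 / 2 * H h h with hG
  have hder : ∀ y ∈ ball (0 : E) r, HasFDerivAt G (D (x + y) - D x - H y) y := by
    intro y hy
    have e1 : HasFDerivAt (fun h => f (x + h)) (D (x + y)) y := by
      simpa [Function.comp_def] using
        (hball y hy).2.hasFDerivAt.comp y ((hasFDerivAt_id y).const_add x)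
    have e2 : HasFDerivAt (fun h => H h h) (H y + H.flip y) y := by
      simpa using H.hasFDerivAt.clm_apply (hasFDerivAt_id y)
    refine (((e1.sub_const (f x)).sub (D x).hasFDerivAt).sub
      (e2.const_mul (1 / 2 : ℝ))).congr_fderiv (ContinuousLinearMap.ext fun v => ?_)
    simp [hsymm v y]
    ring
  have hsub : closedBall (0 : E) ‖h‖ ⊆ ball 0 r :=
    closedBall_subset_ball (by simpa using hh)
  have := (convex_closedBall (0 : E) ‖h‖).norm_image_sub_le_of_norm_hasFDerivWithin_le
    (f := G) (C := c * ‖h‖) (fun y hy => (hder y (hsub hy)).hasFDerivWithinAt)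
    (fun y hy => ((hball y (hsub hy)).1).trans
      (mul_le_mul_of_nonneg_left (by simpa using hy) hc.le))
    (x := 0) (y := h) (by simp) (by simp)
  have hG0 : G 0 = 0 := by simp [hG]
  rw [hG0, sub_zero, sub_zero] at this
  calc ‖G h‖ ≤ c * ‖h‖ * ‖h‖ := this
    _ = c * ‖‖h‖ ^ 2‖ := by rw [norm_pow, norm_norm]; ring

/-- Second-order expansion at `0` of `exp (A τ + B τ² + ε |τ|²)`. -/
theorem Complex.exp_quadratic_isLittleO (A B : ℂ) (ε : ℝ) :
    (fun τ : ℂ => Complex.exp (A * τ + B * τ ^ 2 + ((ε * ‖τ‖ ^ 2 : ℝ) : ℂ)) - 1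
        - A * τ - (B + A ^ 2 / 2) * τ ^ 2 - ((ε * ‖τ‖ ^ 2 : ℝ) : ℂ))
      =o[𝓝 0] fun τ => ‖τ‖ ^ 2 := by
  have hid : (fun τ : ℂ => τ) =O[𝓝 0] fun τ : ℂ => τ := Asymptotics.isBigO_refl _ _
  set b : ℂ → ℂ := fun τ => B * τ ^ 2 + ((ε * ‖τ‖ ^ 2 : ℝ) : ℂ) with hb
  have hb2 : b =O[𝓝 0] fun τ : ℂ => τ ^ 2 := by
    refine Asymptotics.IsBigO.add ((Asymptotics.isBigO_refl _ _).const_mul_left B) ?_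
    refine Asymptotics.IsBigO.of_bound |ε| (Eventually.of_forall fun τ => ?_)
    rw [Complex.norm_real, norm_mul]; simp
  have h21 : (fun τ : ℂ => τ ^ 2) =o[𝓝 0] fun τ : ℂ => τ := by
    simpa using Asymptotics.isLittleO_pow_pow (𝕜 := ℂ) one_lt_two
  have hb1 : b =o[𝓝 0] fun τ : ℂ => τ := hb2.trans_isLittleO h21
  set x : ℂ → ℂ := fun τ => A * τ + b τ with hx
  have hx1 : x =O[𝓝 0] fun τ : ℂ => τ := (hid.const_mul_left A).add hb1.isBigO
  have hx0 : Tendsto x (𝓝 0) (𝓝 0) := by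
    have : Continuous x := by simp only [hx, hb]; fun_prop
    simpa [hx, hb] using this.tendsto 0
  have h3 := ((Complex.exp_sub_sum_range_succ_isLittleO_pow 2).comp_tendsto hx0).trans_isBigO
    (hx1.pow 2)
  have h4 : (fun τ => A * τ * b τ + b τ * b τ / 2) =o[𝓝 0] fun τ : ℂ => τ ^ 2 := by
    simp only [pow_two]
    refine Asymptotics.IsLittleO.add ((hid.const_mul_left A).mul_isLittleO hb1) ?_
    simp only [div_eq_mul_inv, mul_comm _ (2 : ℂ)⁻¹]
    exact (hb1.mul hb1).const_mul_left _
  have h5 := (h3.add h4).norm_right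
  simp only [norm_pow] at h5
  refine h5.congr_left fun τ => ?_
  simp [Finset.sum_range_succ, hx, hb]
  ring_nf

/-- If the Levi form of a `C²` function `f` is nonnegative on complex tangent vectors at a zero `p`
and `a` points in an increasing direction, then there is a disc through `p`, obtained from
`τ ↦ p - a + τ w` by adding a multiple of `a` by an exponential, on which `f` is positive near `p`. -/
theorem exists_exp_curve_pos {E : Type*} [NormedAddCommGroup E] [NormedSpace ℝ E]
    [NormedSpace ℂ E] [IsScalarTower ℝ ℂ E] {f : E → ℝ} {p a : E} (hf : ContDiffAt ℝ 2 f p)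
    (hp : f p = 0) (ha : 0 < fderiv ℝ f p a)
    (hlevi : ∀ X : E, fderiv ℝ f p X = 0 → fderiv ℝ f p (Complex.I • X) = 0 →
      0 ≤ fderiv ℝ (fderiv ℝ f) p X X
        + fderiv ℝ (fderiv ℝ f) p (Complex.I • X) (Complex.I • X))
    (w : E) {ε : ℝ} (hε : 0 < ε) :
    ∃ A B : ℂ, ∀ᶠ τ in 𝓝[≠] (0 : ℂ),
      0 < f (p + (τ • w
        + (Complex.exp (A * τ + B * τ ^ 2 + ((ε * ‖τ‖ ^ 2 : ℝ) : ℂ)) - 1) • a)) := by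
  set D := fderiv ℝ f p with hD
  set H := fderiv ℝ (fderiv ℝ f) p with hH
  have hsm : ∀ (c : ℂ) (v : E), c • v = c.re • v + c.im • (Complex.I • v) := by
    intro c v
    conv_lhs => rw [← Complex.re_add_im c]
    rw [add_smul, mul_smul, ← algebraMap_smul ℂ c.re v, ← algebraMap_smul ℂ c.im (Complex.I • v)]
    rfl
  -- the complex-linear form with real part `D`
  set l : E → ℂ := fun v => D v - Complex.I * D (Complex.I • v) with hl
  have hDl : ∀ (c : ℂ) (v : E), D (c • v) = (c * l v).re := by
    intro c v
    rw [hsm c v]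
    simp [hl]
  have hla : l a ≠ 0 := by
    intro h
    have := congrArg Complex.re h
    simp [hl] at this
    exact ha.ne' this
  obtain ⟨A, hA⟩ : ∃ A : ℂ, A = -(l w / l a) := ⟨_, rfl⟩
  set X := w + A • a with hX
  have hlX : ∀ c : ℂ, D (c • X) = 0 := by
    intro c
    rw [hX, smul_add, map_add, smul_smul, hDl, hDl, ← Complex.add_re]
    have : c * l w + c * A * l a = 0 := by
      rw [hA]; field_simp; ring
    rw [this]; rfl
  set Y := Complex.I • X with hY
  have hL : 0 ≤ H X X + H Y Y := hlevi X (by simpa using hlX 1) (hlX _)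
  set C : ℂ := ((H X X - H Y Y : ℝ) : ℂ) - Complex.I * ((H X Y + H Y X : ℝ) : ℂ) with hC
  obtain ⟨β, hβ⟩ : ∃ β : ℂ, β = -(C / 4 / l a) := ⟨_, rfl⟩
  refine ⟨A, β - A ^ 2 / 2, ?_⟩
  set R : ℂ → ℂ := fun τ => Complex.exp (A * τ + (β - A ^ 2 / 2) * τ ^ 2
    + ((ε * ‖τ‖ ^ 2 : ℝ) : ℂ)) - 1 - A * τ - β * τ ^ 2 - ((ε * ‖τ‖ ^ 2 : ℝ) : ℂ) with hR
  have hRo : R =o[𝓝 0] fun τ => ‖τ‖ ^ 2 := by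
    have h := Complex.exp_quadratic_isLittleO A (β - A ^ 2 / 2) ε
    rwa [show β - A ^ 2 / 2 + A ^ 2 / 2 = β by ring] at h
  set k : ℂ → E := fun τ => (β * τ ^ 2 + ((ε * ‖τ‖ ^ 2 : ℝ) : ℂ) + R τ) • a with hk
  set h : ℂ → E := fun τ => τ • w
        + (Complex.exp (A * τ + (β - A ^ 2 / 2) * τ ^ 2 + ((ε * ‖τ‖ ^ 2 : ℝ) : ℂ)) - 1) • a with hh
  have hhk : ∀ τ, h τ = τ • X + k τ := by
    intro τ
    simp only [hh, hX, hk, hR, smul_add, smul_smul, add_assoc, ← add_smul]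
    congr 2
    ring
  have hk2 : k =O[𝓝 0] fun τ : ℂ => ‖τ‖ ^ 2 := by
    have e : (fun τ : ℂ => β * τ ^ 2 + ((ε * ‖τ‖ ^ 2 : ℝ) : ℂ) + R τ)
        =O[𝓝 0] fun τ : ℂ => ‖τ‖ ^ 2 := by
      refine Asymptotics.IsBigO.add (Asymptotics.IsBigO.add ?_ ?_) hRo.isBigO
      · refine Asymptotics.IsBigO.of_bound ‖β‖ (Eventually.of_forall fun τ => ?_)
        simp
      · refine Asymptotics.IsBigO.of_bound |ε| (Eventually.of_forall fun τ => ?_)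
        rw [Complex.norm_real, norm_mul]; simp
    refine (Asymptotics.IsBigO.of_bound ‖a‖ (Eventually.of_forall fun τ => ?_)).trans e
    rw [hk, norm_smul, mul_comm]
  have h21 : (fun τ : ℂ => ‖τ‖ ^ 2) =o[𝓝 0] fun τ : ℂ => τ := by
    have : (fun τ : ℂ => τ ^ 2) =o[𝓝 0] fun τ : ℂ => τ := by
      simpa using Asymptotics.isLittleO_pow_pow (𝕜 := ℂ) one_lt_two
    simpa using this.norm_left
  have hX1 : (fun τ : ℂ => τ • X) =O[𝓝 0] fun τ : ℂ => τ := by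
    refine Asymptotics.IsBigO.of_bound ‖X‖ (Eventually.of_forall fun τ => ?_)
    rw [norm_smul, mul_comm]
  have hk1 : k =o[𝓝 0] fun τ : ℂ => τ := hk2.trans_isLittleO h21
  have hh1 : h =O[𝓝 0] fun τ : ℂ => τ := by
    simpa only [← hhk] using hX1.add hk1.isBigO
  have hh0 : Tendsto h (𝓝 0) (𝓝 0) := hh1.trans_tendsto tendsto_id
  have hT := (hf.taylor_two_isLittleO.comp_tendsto hh0).trans_isBigO
    ((hh1.norm_norm).pow 2)
  have hH1 : (fun τ => H (τ • X) (k τ) + H (k τ) (τ • X) + H (k τ) (k τ))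
      =o[𝓝 0] fun τ : ℂ => ‖τ‖ ^ 2 := by
    have key : ∀ u v : ℂ → E, (fun τ => H (u τ) (v τ)) =O[𝓝 0] fun τ => ‖u τ‖ * ‖v τ‖ := by
      intro u v
      refine Asymptotics.IsBigO.of_bound ‖H‖ (Eventually.of_forall fun τ => ?_)
      simpa [mul_assoc] using H.le_opNorm₂ (u τ) (v τ)
    simp only [pow_two]
    refine ((((key _ _).trans_isLittleO ?_).add ((key _ _).trans_isLittleO ?_)).add
      ((key _ _).trans_isLittleO ?_))
    · exact hX1.norm_norm.mul_isLittleO hk1.norm_norm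
    · exact hk1.norm_norm.mul_isBigO hX1.norm_norm
    · exact hk1.norm_norm.mul hk1.norm_norm
  have hDR : (fun τ => D (R τ • a)) =o[𝓝 0] fun τ : ℂ => ‖τ‖ ^ 2 := by
    refine Asymptotics.IsBigO.trans_isLittleO
      (Asymptotics.IsBigO.of_bound (‖D‖ * ‖a‖) (Eventually.of_forall fun τ => ?_)) hRo
    calc ‖D (R τ • a)‖ ≤ ‖D‖ * ‖R τ • a‖ := D.le_opNorm _
      _ = _ := by rw [norm_smul]; ring
  have hall := (hT.add hDR).add (hH1.const_mul_left (1 / 2))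
  have hpos : 0 < ε * D a / 2 := by positivity
  have hev := (Asymptotics.isLittleO_iff.1 hall) hpos
  filter_upwards [nhdsWithin_le_nhds hev, self_mem_nhdsWithin] with τ hτ hτ0
  have hτpos : 0 < ‖τ‖ ^ 2 := by
    have : τ ≠ 0 := hτ0
    positivity
  have hDh : D (h τ) = -(C * τ ^ 2).re / 4 + ε * ‖τ‖ ^ 2 * D a + D (R τ • a) := by
    rw [hhk, map_add, hlX, zero_add, hk]
    simp only [add_smul, map_add]
    congr 2
    · rw [hDl]
      have : β * τ ^ 2 * l a = ((-1 / 4 : ℝ) : ℂ) * (C * τ ^ 2) := by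
        rw [hβ]; push_cast; field_simp
      rw [this, Complex.re_ofReal_mul]; ring
    · rw [hDl, Complex.re_ofReal_mul]; simp [hl]
  have hHh : H (h τ) (h τ) = H (τ • X) (τ • X)
      + (H (τ • X) (k τ) + H (k τ) (τ • X) + H (k τ) (k τ)) := by
    rw [hhk]; simp only [map_add, add_apply]; ring
  have hHX : H (τ • X) (τ • X) = ‖τ‖ ^ 2 * (H X X + H Y Y) / 2 + (C * τ ^ 2).re / 2 := by
    rw [hsm τ X, ← hY, Complex.sq_norm, Complex.normSq_apply]
    simp [hC, pow_two]
    ring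
  have hab := (abs_le.1 hτ).1
  simp only [Function.comp_apply, norm_pow, norm_norm] at hab
  rw [hp, hDh, hHh, hHX] at hab
  have : 0 ≤ ‖τ‖ ^ 2 * (H X X + H Y Y) := by positivity
  show 0 < f (p + h τ)
  nlinarith [mul_pos hτpos hpos]

/-- A Hopf-type statement: a function which is nonpositive on a ball and vanishes with nonzero
derivative at the boundary point `z + a` has positive derivative in the radial direction `a`. -/
theorem fderiv_radial_pos {E : Type*} [NormedAddCommGroup E] [NormedSpace ℝ E] {f : E → ℝ}
    {z a : E} (ha : a ≠ 0) (hf : DifferentiableAt ℝ f (z + a)) (hp : f (z + a) = 0)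
    (hneg : ∀ᶠ q in 𝓝 (z + a), q ∈ ball z ‖a‖ → f q ≤ 0) (hne : fderiv ℝ f (z + a) ≠ 0) :
    0 < fderiv ℝ f (z + a) a := by
  set D := fderiv ℝ f (z + a) with hD
  have hna : 0 < ‖a‖ := norm_pos_iff.2 ha
  have key : ∀ v : E, D v ≤ (‖v‖ + 1) / ‖a‖ * D a := by
    intro v
    set t := (‖v‖ + 1) / ‖a‖ with ht
    have hta : t * ‖a‖ = ‖v‖ + 1 := by rw [ht]; field_simp
    have htpos : 0 < t := by positivity
    have hline : HasDerivAt (fun s : ℝ => f ((z + a) + s • (v - t • a))) (D (v - t • a)) 0 :=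
      hf.hasFDerivAt.hasLineDerivAt _
    have hcont : Tendsto (fun s : ℝ => (z + a) + s • (v - t • a)) (𝓝[>] 0) (𝓝 (z + a)) := by
      have : Continuous fun s : ℝ => (z + a) + s • (v - t • a) := by fun_prop
      simpa using (this.tendsto 0).mono_left nhdsWithin_le_nhds
    have hle : D (v - t • a) ≤ 0 := by
      refine le_of_tendsto hline.tendsto_slope_zero_right ?_
      filter_upwards [hcont.eventually hneg, Ioo_mem_nhdsGT (inv_pos.2 htpos)] with s hs hs'
      have hst : s * t < 1 := by
        have := mul_lt_mul_of_pos_right hs'.2 htpos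
        rwa [inv_mul_cancel₀ htpos.ne'] at this
      have hmem : (z + a) + s • (v - t • a) ∈ ball z ‖a‖ := by
        rw [mem_ball_iff_norm]
        have e : (z + a) + s • (v - t • a) - z = (1 - s * t) • a + s • v := by
          module
        rw [e]
        refine (norm_add_le _ _).trans_lt ?_
        rw [norm_smul, norm_smul, Real.norm_of_nonneg (by linarith), Real.norm_of_nonneg hs'.1.le]
        have hs0 := hs'.1
        nlinarith
      have h1 := hs hmem
      simp only [zero_add, zero_smul, add_zero, hp, sub_zero, smul_eq_mul]
      exact mul_nonpos_of_nonneg_of_nonpos (inv_nonneg.2 hs'.1.le) h1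
    simp only [map_sub, map_smul, smul_eq_mul] at hle
    linarith
  by_contra hcon
  push Not at hcon
  refine hne (ContinuousLinearMap.ext fun v => ?_)
  have h1 := (key v).trans (mul_nonpos_of_nonneg_of_nonpos (by positivity) hcon)
  have h2 := (key (-v)).trans (mul_nonpos_of_nonneg_of_nonpos (by positivity) hcon)
  rw [map_neg] at h2
  simp only [zero_apply]
  linarith

theorem infDist_frontier_le_dist_s6 {E : Type*} [NormedAddCommGroup E] [NormedSpace ℝ E]
    [FiniteDimensional ℝ E] {s : Set E} {x y : E} (hx : x ∈ s) (hy : y ∉ s) :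
    infDist x (frontier s) ≤ dist x y := by
  obtain ⟨q, hq, hxq⟩ := exists_mem_frontier_infDist_compl_eq_dist hx
    (ne_univ_iff_exists_notMem s |>.2 ⟨y, hy⟩)
  exact (infDist_le_dist_of_mem hq).trans (hxq ▸ infDist_le_dist_of_mem hy)

/-- On a Levi pseudoconvex domain, `-log d` has along each complex line, up to `ε |τ|²`, a harmonic
quadratic minorant at each point. -/
theorem LeviPseudoconvex.exists_quadratic_le_neg_log_infDist {n : ℕ}
    {Ω : Set (EuclideanSpace ℂ (Fin n))} (hlevi : LeviPseudoconvex Ω) (hopen : IsOpen Ω)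
    (hC2 : HasCkBoundary Ω 2) {z : EuclideanSpace ℂ (Fin n)} (hz : z ∈ Ω)
    (w : EuclideanSpace ℂ (Fin n)) {ε : ℝ} (hε : 0 < ε) :
    ∃ A B : ℂ, ∀ᶠ τ in 𝓝 (0 : ℂ),
      -Real.log (infDist z (frontier Ω)) + (A * τ + B * τ ^ 2).re - ε * ‖τ‖ ^ 2
        ≤ -Real.log (infDist (z + τ • w) (frontier Ω)) := by
  rcases (frontier Ω).eq_empty_or_nonempty with hF | hF
  · refine ⟨0, 0, Eventually.of_forall fun τ => ?_⟩
    simp only [hF, infDist_empty]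
    simp
    positivity
  have hdisj : ∀ q ∈ frontier Ω, q ∉ Ω := fun q hq hq' => by
    rw [hopen.frontier_eq] at hq
    exact hq.2 hq'
  have hdpos : ∀ y ∈ Ω, 0 < infDist y (frontier Ω) := fun y hy =>
    (isClosed_frontier.notMem_iff_infDist_pos hF).1 fun h => hdisj y h hy
  obtain ⟨p, hpF, hzp⟩ := isClosed_frontier.exists_infDist_eq_dist hF z
  obtain ⟨a, rfl⟩ : ∃ a, p = z + a := ⟨p - z, by abel⟩
  have hna : infDist z (frontier Ω) = ‖a‖ := by simpa [dist_eq_norm] using hzp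
  have ha : a ≠ 0 := norm_pos_iff.1 (hna ▸ hdpos z hz)
  have hball : ball z ‖a‖ ⊆ Ω := fun q hq => by
    by_contra hqΩ
    have := infDist_frontier_le_dist_s6 hz hqΩ
    rw [hna, dist_comm] at this
    exact absurd (mem_ball.1 hq) (not_lt.2 this)
  obtain ⟨V, ρ, hdef⟩ := hC2 _ hpF
  obtain ⟨hVo, hpV, hρ, hgrad, hneg, hzero⟩ := id hdef
  have hρp : ContDiffAt ℝ 2 ρ (z + a) := hρ.contDiffAt (hVo.mem_nhds hpV)
  have hρ0 : ρ (z + a) = 0 := (hzero.subset ⟨hpF, hpV⟩).2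
  have hDa : 0 < fderiv ℝ ρ (z + a) a := by
    refine fderiv_radial_pos ha (hρp.differentiableAt two_ne_zero) hρ0 ?_ (hgrad _ ⟨hpV, hpF⟩)
    filter_upwards [hVo.mem_nhds hpV] with q hqV hq
    exact (hneg.subset ⟨hball hq, hqV⟩).2.le
  have hD2 : ∀ X : EuclideanSpace ℂ (Fin n), fderiv ℝ (fun q => fderiv ℝ ρ q X) (z + a) X
      = fderiv ℝ (fderiv ℝ ρ) (z + a) X X := by
    intro X
    have h1 : HasFDerivAt (fderiv ℝ ρ) (fderiv ℝ (fderiv ℝ ρ) (z + a)) (z + a) :=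
      ((hρp.fderiv_right (m := 1) (by norm_num)).differentiableAt one_ne_zero).hasFDerivAt
    rw [(h1.clm_apply (hasFDerivAt_const X (z + a))).fderiv]
    simp
  obtain ⟨A, B, hAB⟩ := exists_exp_curve_pos hρp hρ0 hDa (fun X h1 h2 => by
    have := hlevi _ hpF V ρ hdef X h1 h2
    rwa [hD2, hD2] at this) w hε
  refine ⟨-A, -B, ?_⟩
  have hcont : Continuous fun τ : ℂ => (z + a) + (τ • w
        + (Complex.exp (A * τ + B * τ ^ 2 + ((ε * ‖τ‖ ^ 2 : ℝ) : ℂ)) - 1) • a) := by fun_prop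
  have hcV := (hcont.tendsto 0).eventually (hVo.mem_nhds (by simpa using hpV))
  have hcz : ∀ᶠ τ in 𝓝 (0 : ℂ), z + τ • w ∈ Ω := by
    have : Continuous fun τ : ℂ => z + τ • w := by fun_prop
    exact (this.tendsto 0).eventually (hopen.mem_nhds (by simpa using hz))
  filter_upwards [eventually_nhdsWithin_iff.1 hAB, hcV, hcz] with τ hτ hτV hτz
  by_cases hτ0 : τ = 0
  · simp [hτ0]
  set x := Complex.exp (A * τ + B * τ ^ 2 + ((ε * ‖τ‖ ^ 2 : ℝ) : ℂ)) with hx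
  have hnot : (z + a) + (τ • w + (x - 1) • a) ∉ Ω := fun h =>
    absurd (hneg.subset ⟨h, hτV⟩).2 (not_lt.2 (hτ hτ0).le)
  have hle := infDist_frontier_le_dist_s6 hτz hnot
  have e : dist (z + τ • w) ((z + a) + (τ • w + (x - 1) • a)) = ‖x‖ * ‖a‖ := by
    rw [dist_eq_norm, ← norm_smul, ← norm_neg]
    congr 1
    module
  rw [e, hx, Complex.norm_exp] at hle
  have hlog := Real.log_le_log (hdpos _ hτz) hle
  rw [Real.log_mul (Real.exp_pos _).ne' (norm_pos_iff.2 ha).ne', Real.log_exp] at hlog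
  rw [hna]
  simp only [Complex.add_re, Complex.ofReal_re, neg_mul, Complex.neg_re] at hlog ⊢
  linarith

/-- Maximum principle: a function with almost harmonic quadratic minorants at each point of the
disc is dominated at the center by each `Re f`, `f` entire, that dominates it on the circle. -/
theorem le_re_of_quadratic_minorants {v : ℂ → ℝ} (hv : ContinuousOn v (closedBall 0 1))
    (hloc : ∀ ζ ∈ ball (0 : ℂ) 1, ∀ ε > 0, ∃ A B : ℂ, ∀ᶠ τ in 𝓝 (0 : ℂ),
      v ζ + (A * τ + B * τ ^ 2).re - ε * ‖τ‖ ^ 2 ≤ v (ζ + τ))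
    {f : ℂ → ℂ} (hf : Differentiable ℂ f) (hvf : ∀ ζ ∈ sphere (0 : ℂ) 1, v ζ ≤ (f ζ).re) :
    v 0 ≤ (f 0).re := by
  by_contra hcon
  push Not at hcon
  obtain ⟨η, hη⟩ : ∃ η, η = (v 0 - (f 0).re) / 2 := ⟨_, rfl⟩
  have hη0 : 0 < η := by linarith
  have hfc : Continuous fun ζ => (f ζ).re := Complex.continuous_re.comp hf.continuous
  obtain ⟨ζ, hζ, hmax⟩ := (isCompact_closedBall (0 : ℂ) 1).exists_isMaxOn ⟨0, by simp⟩
    (f := fun ζ => v ζ - (f ζ).re + η * ‖ζ‖ ^ 2)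
    ((hv.sub hfc.continuousOn).add (by fun_prop))
  have hζb : ζ ∈ ball (0 : ℂ) 1 := by
    by_contra hnb
    have hn : ‖ζ‖ = 1 := le_antisymm (by simpa using hζ) (by simpa using hnb)
    have h0 := isMaxOn_iff.1 hmax 0 (by simp)
    have h1 := hvf ζ (by simpa using hn)
    simp only [hn, norm_zero] at h0
    linarith
  obtain ⟨A, B, hAB⟩ := hloc ζ hζb (η / 2) (by positivity)
  set G : ℂ → ℂ := fun τ => f (ζ + τ) - f ζ - A * τ - B * τ ^ 2
    - ((2 * η : ℝ) : ℂ) * (starRingEnd ℂ ζ * τ) with hG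
  have hGd : Differentiable ℂ G := by fun_prop
  have hGre : ∀ᶠ τ in 𝓝 (0 : ℂ), η / 2 * ‖τ‖ ^ 2 ≤ (G τ).re := by
    have hnear : ∀ᶠ τ in 𝓝 (0 : ℂ), ζ + τ ∈ ball (0 : ℂ) 1 := by
      have : Continuous fun τ : ℂ => ζ + τ := by fun_prop
      exact (this.tendsto 0).eventually (isOpen_ball.mem_nhds (by simpa using hζb))
    filter_upwards [hAB, hnear] with τ hτ hτb
    have h1 := isMaxOn_iff.1 hmax _ (ball_subset_closedBall hτb)
    have h2 : ‖ζ + τ‖ ^ 2 = ‖ζ‖ ^ 2 + ‖τ‖ ^ 2 + 2 * (starRingEnd ℂ ζ * τ).re := by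
      simp only [Complex.sq_norm, Complex.normSq_apply, Complex.add_re, Complex.add_im,
        Complex.mul_re, Complex.conj_re, Complex.conj_im]
      ring
    rw [h2] at h1
    simp only [hG, Complex.sub_re, Complex.re_ofReal_mul, Complex.add_re] at hτ h1 ⊢
    linarith
  have hG0 : G 0 = 0 := by simp [hG]
  have hconst := Complex.eventually_eq_of_isLocalMax_norm (f := fun τ => Complex.exp (-G τ))
    (c := 0) (Eventually.of_forall fun τ => by fun_prop) (by
      filter_upwards [hGre] with τ hτ
      simp only [Function.comp_apply, Complex.norm_exp, hG0, neg_zero, Complex.zero_re,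
        Real.exp_zero, Complex.neg_re]
      rw [Real.exp_le_one_iff]
      have : 0 ≤ η / 2 * ‖τ‖ ^ 2 := by positivity
      linarith)
  obtain ⟨τ, ⟨h1, h2⟩, hτ0⟩ := (((hconst.and hGre).filter_mono
    (nhdsWithin_le_nhds (s := {0}ᶜ))).and self_mem_nhdsWithin).exists
  have h3 := congrArg norm h1
  simp only [Complex.norm_exp, hG0, neg_zero, Complex.zero_re, Real.exp_zero,
    Complex.neg_re, Real.exp_eq_one_iff] at h3
  have hτ' : τ ≠ 0 := hτ0
  have : 0 < η / 2 * ‖τ‖ ^ 2 := by positivity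
  linarith

/-- Continuous functions on the unit circle are uniform limits of real parts of entire functions. -/
theorem exists_differentiable_re_approx_on_sphere {v : ℂ → ℝ}
    (hv : ContinuousOn v (sphere (0 : ℂ) 1)) {δ : ℝ} (hδ : 0 < δ) :
    ∃ f : ℂ → ℂ, Differentiable ℂ f ∧ ∀ ζ ∈ sphere (0 : ℂ) 1, |v ζ - (f ζ).re| ≤ δ := by
  have : Fact (0 < 2 * Real.pi) := ⟨Real.two_pi_pos⟩
  have hmem : ∀ x : AddCircle (2 * Real.pi), (AddCircle.toCircle x : ℂ) ∈ sphere (0 : ℂ) 1 :=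
    fun x => mem_sphere_zero_iff_norm.2 (Circle.norm_coe _)
  let g : C(AddCircle (2 * Real.pi), ℂ) := ⟨fun x => (v (AddCircle.toCircle x : ℂ) : ℂ), by
    refine Complex.continuous_ofReal.comp (hv.comp_continuous ?_ hmem)
    exact continuous_subtype_val.comp AddCircle.continuous_toCircle⟩
  have hg : g ∈ closure (Submodule.span ℂ (range (@fourier (2 * Real.pi))) :
      Set C(AddCircle (2 * Real.pi), ℂ)) := by
    rw [← Submodule.topologicalClosure_coe, span_fourier_closure_eq_top]; trivial
  obtain ⟨t, ht, htg⟩ := Metric.mem_closure_iff.1 hg δ hδ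
  have hrep : ∃ P Q : ℂ → ℂ, Differentiable ℂ P ∧ Differentiable ℂ Q ∧
      ∀ x, t x = P (AddCircle.toCircle x) + starRingEnd ℂ (Q (AddCircle.toCircle x)) := by
    clear htg
    induction ht using Submodule.span_induction with
    | mem y hy =>
      obtain ⟨m, rfl⟩ := hy
      obtain ⟨k, rfl | rfl⟩ := m.eq_nat_or_neg
      · refine ⟨fun z => z ^ k, 0, by fun_prop, by fun_prop, fun x => ?_⟩
        simp [fourier_apply, AddCircle.toCircle_nsmul]
      · refine ⟨0, fun z => z ^ k, by fun_prop, by fun_prop, fun x => ?_⟩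
        rw [fourier_neg]
        simp [fourier_apply, AddCircle.toCircle_nsmul]
    | zero => exact ⟨0, 0, by fun_prop, by fun_prop, fun x => by simp⟩
    | add y₁ y₂ _ _ h₁ h₂ =>
      obtain ⟨P₁, Q₁, hP₁, hQ₁, e₁⟩ := h₁
      obtain ⟨P₂, Q₂, hP₂, hQ₂, e₂⟩ := h₂
      refine ⟨P₁ + P₂, Q₁ + Q₂, by fun_prop, by fun_prop, fun x => ?_⟩
      simp [e₁, e₂]
      ring
    | smul c y _ h =>
      obtain ⟨P, Q, hP, hQ, e⟩ := h
      refine ⟨c • P, starRingEnd ℂ c • Q, by fun_prop, by fun_prop, fun x => ?_⟩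
      simp [e]
      ring
  obtain ⟨P, Q, hP, hQ, hPQ⟩ := hrep
  refine ⟨P + Q, by fun_prop, fun ζ hζ => ?_⟩
  obtain ⟨x, hx⟩ : ∃ x : AddCircle (2 * Real.pi), (AddCircle.toCircle x : ℂ) = ζ := by
    obtain ⟨x, hx⟩ := (AddCircle.homeomorphCircle (T := 2 * Real.pi) (by positivity)).surjective
      ⟨ζ, by simpa [Submonoid.unitSphere] using hζ⟩
    exact ⟨x, by simpa [AddCircle.homeomorphCircle_apply] using congrArg Subtype.val hx⟩
  have h1 := (ContinuousMap.dist_apply_le_dist (f := g) (g := t) x).trans htg.le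
  rw [dist_eq_norm] at h1
  have h2 := (Complex.abs_re_le_norm _).trans h1
  have h3 : (g x - t x).re = v ζ - ((P + Q) ζ).re := by
    simp [g, hPQ, hx]
  rwa [h3] at h2

/-- A function with almost harmonic quadratic minorants at each point of the disc satisfies the
sub-mean value inequality on the unit circle. -/
theorem le_circleAverage_of_quadratic_minorants {v : ℂ → ℝ}
    (hv : ContinuousOn v (closedBall 0 1))
    (hloc : ∀ ζ ∈ ball (0 : ℂ) 1, ∀ ε > 0, ∃ A B : ℂ, ∀ᶠ τ in 𝓝 (0 : ℂ),
      v ζ + (A * τ + B * τ ^ 2).re - ε * ‖τ‖ ^ 2 ≤ v (ζ + τ)) :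
    v 0 ≤ Real.circleAverage v 0 1 := by
  have hvs := hv.mono sphere_subset_closedBall
  refine le_of_forall_pos_le_add fun δ hδ => ?_
  obtain ⟨f, hf, happ⟩ := exists_differentiable_re_approx_on_sphere hvs (half_pos hδ)
  have h1 := le_re_of_quadratic_minorants hv hloc (f := fun ζ => f ζ + ((δ / 2 : ℝ) : ℂ))
    (by fun_prop) (fun ζ hζ => by
      have := (abs_le.1 (happ ζ hζ)).2
      simp only [Complex.add_re, Complex.ofReal_re]
      linarith)
  have hvi : CircleIntegrable v 0 1 := hvs.circleIntegrable zero_le_one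
  have hfi : CircleIntegrable f 0 1 := hf.continuous.continuousOn.circleIntegrable zero_le_one
  have hmean : Real.circleAverage (fun ζ => (f ζ).re) 0 1 = (f 0).re := by
    have h := Complex.reCLM.circleAverage_comp_comm hfi
    rw [hf.diffContOnCl.circleAverage] at h
    exact h
  have h2 : Real.circleAverage (fun ζ => (f ζ).re) 0 1
      ≤ Real.circleAverage (fun ζ => v ζ + δ / 2) 0 1 := by
    refine Real.circleAverage_mono ?_ ?_ fun ζ hζ => ?_
    · exact (Complex.continuous_re.comp hf.continuous).continuousOn.circleIntegrable zero_le_one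
    · exact (hvs.add continuousOn_const).circleIntegrable zero_le_one
    · have := (abs_le.1 (happ ζ (by simpa using hζ))).1
      linarith
  have h3 : Real.circleAverage (fun ζ => v ζ + δ / 2) 0 1
      = Real.circleAverage v 0 1 + δ / 2 := by
    rw [Real.circleAverage_fun_add hvi (circleIntegrable_const _ _ _), Real.circleAverage_const]
  simp only [Complex.add_re, Complex.ofReal_re] at h1
  linarith

theorem setIntegral_ball_smul_of_norm_eq_one {n : ℕ} (g : EuclideanSpace ℂ (Fin n) → ℝ)
    (x : EuclideanSpace ℂ (Fin n)) (r : ℝ) {c : ℂ} (hc : ‖c‖ = 1) :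
    ∫ y in ball (0 : EuclideanSpace ℂ (Fin n)) r, g (x + c • y) = ∫ y in ball x r, g y := by
  let u : Circle := ⟨c, mem_sphere_zero_iff_norm.2 hc⟩
  let L : EuclideanSpace ℂ (Fin n) ≃ₗᵢ[ℝ] EuclideanSpace ℂ (Fin n) :=
    { DistribMulAction.toLinearEquiv ℝ (EuclideanSpace ℂ (Fin n)) u with
      norm_map' := fun y => by
        show ‖c • y‖ = ‖y‖
        rw [norm_smul, hc, one_mul] }
  have hmp : MeasurePreserving (fun y => x + L y) volume volume :=
    (measurePreserving_add_left volume x).comp L.measurePreserving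
  have hemb : MeasurableEmbedding fun y => x + L y :=
    (MeasurableEquiv.addLeft x).measurableEmbedding.comp L.toMeasurableEquiv.measurableEmbedding
  have hpre : (fun y => x + L y) ⁻¹' ball x r = ball 0 r := by
    ext y
    simp
  rw [← hmp.setIntegral_preimage_emb hemb g (ball x r), hpre]
  rfl

/-- The sub-mean value inequality on circles in complex lines implies the one on balls. -/
theorem le_ball_average_of_le_circleAverage {n : ℕ} {g : EuclideanSpace ℂ (Fin n) → ℝ}
    {x : EuclideanSpace ℂ (Fin n)} {r : ℝ} (hr : 0 < r) (hg : ContinuousOn g (closedBall x r))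
    (hcirc : ∀ y ∈ ball (0 : EuclideanSpace ℂ (Fin n)) r,
      g x ≤ Real.circleAverage (fun τ : ℂ => g (x + τ • y)) 0 1) :
    g x ≤ (volume (ball x r)).toReal⁻¹ * ∫ y in ball x r, g y := by
  have hmeas : volume.real (ball (0 : EuclideanSpace ℂ (Fin n)) r) = volume.real (ball x r) := by
    rw [measureReal_def, measureReal_def, Measure.addHaar_ball_center volume x r]
  have hpos : 0 < volume.real (ball x r) :=
    ENNReal.toReal_pos (measure_ball_pos _ _ hr).ne' measure_ball_lt_top.ne
  set F : EuclideanSpace ℂ (Fin n) → ℝ → ℝ := fun y θ => g (x + circleMap 0 1 θ • y) with hF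
  have hFc : ContinuousOn (Function.uncurry F)
      (closedBall (0 : EuclideanSpace ℂ (Fin n)) r ×ˢ Icc 0 (2 * Real.pi)) := by
    refine hg.comp (f := fun q : EuclideanSpace ℂ (Fin n) × ℝ => x + circleMap 0 1 q.2 • q.1)
      (Continuous.continuousOn (by fun_prop)) ?_
    rintro ⟨y, θ⟩ ⟨hy, -⟩
    simpa [mem_closedBall_iff_norm, norm_smul] using hy
  have hFi : Integrable (Function.uncurry F)
      ((volume.restrict (ball (0 : EuclideanSpace ℂ (Fin n)) r)).prod
        (volume.restrict (Ioc 0 (2 * Real.pi)))) := by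
    rw [Measure.prod_restrict]
    exact (hFc.integrableOn_compact ((isCompact_closedBall _ _).prod isCompact_Icc)).mono_set
      (prod_mono ball_subset_closedBall Ioc_subset_Icc_self)
  have hswap := integral_integral_swap hFi
  have hinner : ∀ θ : ℝ, ∫ y in ball (0 : EuclideanSpace ℂ (Fin n)) r, F y θ
      = ∫ y in ball x r, g y := fun θ =>
    setIntegral_ball_smul_of_norm_eq_one g x r (by simp)
  simp only [hinner] at hswap
  rw [setIntegral_const, Real.volume_real_Ioc_of_le Real.two_pi_pos.le, sub_zero,
    smul_eq_mul] at hswap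
  have hle : ∫ y in ball (0 : EuclideanSpace ℂ (Fin n)) r, 2 * Real.pi * g x
      ≤ ∫ y in ball (0 : EuclideanSpace ℂ (Fin n)) r, ∫ θ in Ioc 0 (2 * Real.pi), F y θ := by
    refine setIntegral_mono_on (integrableOn_const measure_ball_lt_top.ne) hFi.integral_prod_left
      measurableSet_ball fun y hy => ?_
    have h := hcirc y hy
    rw [Real.circleAverage, smul_eq_mul, intervalIntegral.integral_of_le Real.two_pi_pos.le,
      le_inv_mul_iff₀ Real.two_pi_pos] at h
    exact h
  rw [hswap, setIntegral_const, smul_eq_mul, hmeas] at hle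
  rw [← measureReal_def, le_inv_mul_iff₀ hpos]
  have htwopi := Real.two_pi_pos
  nlinarith

theorem erealBallAvg_coe_s6 {n : ℕ} {g : EuclideanSpace ℂ (Fin n) → ℝ}
    {x : EuclideanSpace ℂ (Fin n)} {r : ℝ} (hr : 0 < r) (hg : IntegrableOn g (ball x r)) :
    erealBallAvg (fun z => (g z : EReal)) x r
      = (((volume (ball x r)).toReal⁻¹ * ∫ y in ball x r, g y : ℝ) : EReal) := by
  have hv0 := (measure_ball_pos volume x hr).ne'
  have h1 : ∫⁻ y in ball x r, ENNReal.ofReal (g y) ≠ ⊤ := hg.lintegral_lt_top.ne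
  have h2 : ∫⁻ y in ball x r, ENNReal.ofReal (-(g y)) ≠ ⊤ := hg.neg.lintegral_lt_top.ne
  have e1 : ∀ y : ℝ, erealToENNReal (y : EReal) = ENNReal.ofReal y := fun y => by
    simp [erealToENNReal]
  simp only [erealBallAvg, ← EReal.coe_neg, e1]
  rw [integral_eq_lintegral_pos_part_sub_lintegral_neg_part hg,
    ← EReal.coe_ennreal_toReal (ENNReal.div_ne_top h1 hv0),
    ← EReal.coe_ennreal_toReal (ENNReal.div_ne_top h2 hv0), ← EReal.coe_sub,
    ENNReal.toReal_div, ENNReal.toReal_div]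
  congr 1
  ring

theorem continuousOn_neg_log_infDist_frontier {E : Type*} [PseudoMetricSpace E] {s : Set E}
    (hs : IsOpen s) : ContinuousOn (fun z => -Real.log (infDist z (frontier s))) s := by
  rcases (frontier s).eq_empty_or_nonempty with hF | hF
  · simpa only [hF, infDist_empty] using continuousOn_const
  · refine ((continuous_infDist_pt _).continuousOn.log fun z hz => ?_).neg
    refine ((isClosed_frontier.notMem_iff_infDist_pos hF).1 fun h => ?_).ne'
    rw [hs.frontier_eq] at h
    exact h.2 hz

/-- Theorem (statement 6): if `Ω ⊆ ℂⁿ` is a bounded Levi pseudoconvex domain with `C²`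
boundary then, viewing `Ω` as a domain in `ℝ²ⁿ`, the function `z ↦ -log(d_{∂Ω}(z))` is
subharmonic on the whole domain `Ω`. -/
theorem negLogDist_subharmonic_pseudoconvex (n : ℕ) (Ω : Set (EuclideanSpace ℂ (Fin n)))
    (hopen : IsOpen Ω) (hconn : IsConnected Ω) (hbdd : Bornology.IsBounded Ω)
    (hC2 : HasCkBoundary Ω 2) (hlevi : LeviPseudoconvex Ω) :
    IsSubharmonicOn
      (fun z => ((- Real.log (infDist z (frontier Ω)) : ℝ) : EReal)) Ω := by
  have hcont := continuousOn_neg_log_infDist_frontier hopen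
  refine ⟨(continuous_coe_real_ereal.comp_continuousOn hcont).upperSemicontinuousOn, fun h => ?_,
    fun z _ => EReal.coe_lt_top _, fun x _ => ⟨1, one_pos, fun r hr _ hsub => ?_⟩⟩
  · obtain ⟨z, hz⟩ := hconn.nonempty
    exact EReal.coe_ne_bot _ (h z hz)
  have hcb := hcont.mono hsub
  have hint : IntegrableOn (fun z => -Real.log (infDist z (frontier Ω))) (ball x r) :=
    (hcb.integrableOn_compact (isCompact_closedBall x r)).mono_set ball_subset_closedBall
  rw [erealBallAvg_coe_s6 hr hint, EReal.coe_le_coe_iff]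
  refine le_ball_average_of_le_circleAverage hr hcb fun y hy => ?_
  have hmem : ∀ ζ ∈ closedBall (0 : ℂ) 1, x + ζ • y ∈ Ω := fun ζ hζ => hsub <| by
    have h1 : ‖ζ‖ ≤ 1 := by simpa using hζ
    have h2 : ‖y‖ ≤ r := by simpa using (mem_ball.1 hy).le
    rw [mem_closedBall_iff_norm, add_sub_cancel_left, norm_smul]
    exact (mul_le_of_le_one_left (norm_nonneg y) h1).trans h2
  have h := le_circleAverage_of_quadratic_minorants
    (v := fun ζ => -Real.log (infDist (x + ζ • y) (frontier Ω)))
    (hcont.comp (f := fun ζ : ℂ => x + ζ • y) (by fun_prop) hmem) fun ζ hζ ε hε => by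
      simpa only [add_smul, ← add_assoc] using
        hlevi.exists_quadratic_le_neg_log_infDist hopen hC2
          (hmem ζ (ball_subset_closedBall hζ)) y hε
  simpa using h

end
end
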